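/- arXiv:2010.09796 — 2 statements merged into one kernel-verified Lean document; each statement's English description precedes it below -/
import Mathlib

section
/- Let 0 ≤ t < b ≤ v − t be integers. There exists a non-null p-ary t-design of block size b on {1,…,v} if and only if for every 0 ≤ i ≤ t, C(b − i, t − i) ≡ 0 (mod p) implies C(v − i, t − i) ≡ 0 (mod p). -/
open Finset

/-- The ballot subsets of `range v`: sets `S` with `2 * #(S ∩ range n) ≤ n` for all `n ≤ v`. -/
def ballotSets : ℕ → Finset (Finset ℕ)
  | 0 => {∅}
  | v + 1 => ballotSets v ∪
      ((ballotSets v).filter fun S => 2 * (S.card + 1) ≤ v + 1).image (insert v)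

lemma subset_range_of_mem_ballotSets {v : ℕ} :
    ∀ {S : Finset ℕ}, S ∈ ballotSets v → S ⊆ range v := by
  induction v with
  | zero => intro S hS; simp [ballotSets] at hS; simp [hS]
  | succ v ih =>
    intro S hS
    simp only [ballotSets, mem_union, mem_image, mem_filter] at hS
    rw [range_add_one]
    rcases hS with hS | ⟨S, ⟨hS, -⟩, rfl⟩
    · exact (ih hS).trans (subset_insert _ _)
    · exact insert_subset_insert _ (ih hS)

lemma notMem_of_mem_ballotSets {v : ℕ} {S : Finset ℕ} (hS : S ∈ ballotSets v) : v ∉ S :=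
  fun h => notMem_range_self (subset_range_of_mem_ballotSets hS h)

lemma two_mul_card_le_of_mem_ballotSets {v : ℕ} :
    ∀ {S : Finset ℕ}, S ∈ ballotSets v → 2 * S.card ≤ v := by
  induction v with
  | zero => intro S hS; simp [ballotSets] at hS; simp [hS]
  | succ v ih =>
    intro S hS
    simp only [ballotSets, mem_union, mem_image, mem_filter] at hS
    rcases hS with hS | ⟨S, ⟨hS, h⟩, rfl⟩
    · exact (ih hS).trans v.le_succ
    · rwa [card_insert_of_notMem (notMem_of_mem_ballotSets hS)]

lemma sum_ballotSets_succ {M : Type*} [AddCommMonoid M] (v : ℕ) (f : Finset ℕ → M) :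
    ∑ S ∈ ballotSets (v + 1), f S = ∑ S ∈ ballotSets v, f S +
      ∑ S ∈ ballotSets v, if 2 * (S.card + 1) ≤ v + 1 then f (insert v S) else 0 := by
  rw [ballotSets, sum_union, sum_image, sum_filter]
  · intro S hS T hT h
    rw [mem_coe, mem_filter] at hS hT
    rw [← erase_insert (notMem_of_mem_ballotSets hS.1), h,
      erase_insert (notMem_of_mem_ballotSets hT.1)]
  · rw [disjoint_left]
    intro S hS hS'
    simp only [mem_image, mem_filter] at hS'
    obtain ⟨T, -, rfl⟩ := hS'
    exact notMem_of_mem_ballotSets hS (mem_insert_self _ _)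

lemma card_ballotSets_filter {v : ℕ} :
    ∀ {m : ℕ}, 2 * m ≤ v → ((ballotSets v).filter fun S => S.card ≤ m).card = v.choose m := by
  induction v with
  | zero =>
    intro m hm
    obtain rfl : m = 0 := by omega
    simp [ballotSets, filter_singleton]
  | succ v ih =>
    intro m hm
    rw [card_filter, sum_ballotSets_succ]
    rcases m with _ | m
    · have h0 := ih (m := 0) (by omega)
      rw [card_filter] at h0
      rw [h0, sum_eq_zero]
      · simp
      · intro S hS
        simp
    · have hsnd : (∑ S ∈ ballotSets v, if 2 * (S.card + 1) ≤ v + 1 then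
          (if (insert v S).card ≤ m + 1 then 1 else 0) else 0) = v.choose m := by
        rw [← ih (m := m) (by omega), card_filter]
        refine sum_congr rfl fun S hS => ?_
        rw [card_insert_of_notMem (notMem_of_mem_ballotSets hS)]
        split_ifs <;> first | rfl | omega
      rw [hsnd, Nat.choose_succ_succ, add_comm]
      congr 1
      by_cases h : 2 * (m + 1) ≤ v
      · rw [← ih h, card_filter]
      · obtain rfl : v = 2 * m + 1 := by omega
        rw [Nat.choose_symm_half, ← ih (m := m) (by omega), card_filter]
        refine sum_congr rfl fun S hS => ?_
        have := two_mul_card_le_of_mem_ballotSets hS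
        split_ifs <;> first | rfl | omega

/-- The evaluation at `X` of the multilinear polynomial with coefficients `a` on the
ballot monomials. -/
def ballotEval {k : Type*} [AddCommMonoid k] (v : ℕ) (a : Finset ℕ → k) (X : Finset ℕ) : k :=
  ∑ S ∈ ballotSets v, if S ⊆ X then a S else 0

/-- The coefficients of the terms divisible by the last variable. -/
def lastCoeff {k : Type*} [Zero k] (v : ℕ) (a : Finset ℕ → k) (S : Finset ℕ) : k :=
  if 2 * (S.card + 1) ≤ v + 1 then a (insert v S) else 0

lemma ballotEval_succ {k : Type*} [AddCommMonoid k] {v : ℕ} (a : Finset ℕ → k) {X : Finset ℕ}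
    (hX : X ⊆ range v) : ballotEval (v + 1) a X = ballotEval v a X := by
  have hv : v ∉ X := fun h => notMem_range_self (hX h)
  simp [ballotEval, sum_ballotSets_succ, insert_subset_iff, hv]

lemma ballotEval_succ_insert {k : Type*} [AddCommMonoid k] {v : ℕ} (a : Finset ℕ → k)
    (X : Finset ℕ) :
    ballotEval (v + 1) a (insert v X) = ballotEval v (a + lastCoeff v a) X := by
  rw [ballotEval, sum_ballotSets_succ, ballotEval, ← sum_add_distrib]
  refine sum_congr rfl fun S hS => ?_
  have hv := notMem_of_mem_ballotSets hS
  have h : insert v S ⊆ insert v X ↔ S ⊆ X := insert_subset_insert_iff hv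
  simp only [h, subset_insert_iff_of_notMem hv, lastCoeff, Pi.add_apply]
  split_ifs <;> simp

lemma ballotEval_congr {k : Type*} [AddCommMonoid k] {v : ℕ} {a a' : Finset ℕ → k}
    (h : ∀ S ∈ ballotSets v, a S = a' S) (X : Finset ℕ) :
    ballotEval v a X = ballotEval v a' X :=
  sum_congr rfl fun S hS => by rw [h S hS]

/-- The ballot monomials of degree at most `t` are linearly independent on the slice of
`b`-subsets of `range v`. -/
lemma eq_zero_of_ballotEval_eq_zero {k : Type*} [AddCommMonoid k] {v : ℕ} :
    ∀ {b t : ℕ} {a : Finset ℕ → k}, t ≤ b → b + t ≤ v →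
      (∀ S ∈ ballotSets v, t < S.card → a S = 0) →
      (∀ X ∈ powersetCard b (range v), ballotEval v a X = 0) →
      ∀ S ∈ ballotSets v, a S = 0 := by
  induction v with
  | zero =>
    intro b t a htb hbt _ h S hS
    obtain rfl : b = 0 := by omega
    have := h ∅ (by simp)
    simp [ballotEval, ballotSets] at this hS
    rwa [hS]
  | succ v ih =>
    intro b t a htb hbt ha h
    have hmem : ∀ S ∈ ballotSets v, S ∈ ballotSets (v + 1) := fun S hS => by
      simp [ballotSets, hS]
    have hout : ∀ X ∈ powersetCard b (range v), ballotEval v a X = 0 := fun X hX => by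
      rw [mem_powersetCard] at hX
      rw [← ballotEval_succ a hX.1]
      refine h X (mem_powersetCard.2 ⟨hX.1.trans (range_mono v.le_succ), hX.2⟩)
    have hins : ∀ b', b = b' + 1 → ∀ X ∈ powersetCard b' (range v),
        ballotEval v (a + lastCoeff v a) X = 0 := fun b' hb' X hX => by
      rw [mem_powersetCard] at hX
      rw [← ballotEval_succ_insert]
      refine h _ (mem_powersetCard.2 ⟨?_, ?_⟩)
      · rw [range_add_one]
        exact insert_subset_insert _ hX.1
      · rw [card_insert_of_notMem fun h => notMem_range_self (hX.1 h), hX.2, hb']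
    have hlast : ∀ S ∈ ballotSets v, t ≤ S.card → lastCoeff v a S = 0 := fun S hS hS' => by
      rw [lastCoeff]
      split_ifs with h2
      · refine ha _ ?_ ?_
        · simp only [ballotSets, mem_union, mem_image, mem_filter]
          exact Or.inr ⟨S, ⟨hS, h2⟩, rfl⟩
        · rw [card_insert_of_notMem (notMem_of_mem_ballotSets hS)]
          omega
      · rfl
    have key : (∀ S ∈ ballotSets v, a S = 0) ∧ ∀ S ∈ ballotSets v, lastCoeff v a S = 0 := by
      by_cases hv : b + t ≤ v
      · have h0 := ih htb hv (fun S hS => ha S (hmem S hS)) hout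
        refine ⟨h0, ?_⟩
        rcases t with _ | t
        · exact fun S hS => hlast S hS (Nat.zero_le _)
        · obtain ⟨b, rfl⟩ : ∃ b', b = b' + 1 := ⟨b - 1, by omega⟩
          refine ih (b := b) (t := t) (by omega) (by omega) hlast fun X hX => ?_
          rw [← hins b rfl X hX]
          exact ballotEval_congr (fun S hS => by simp [h0 S hS]) X
      · obtain ⟨b, rfl⟩ : ∃ b', b = b' + 1 := ⟨b - 1, by omega⟩
        have h1 : ∀ S ∈ ballotSets v, a S + lastCoeff v a S = 0 := by
          refine ih (b := b) (t := min t b) (by omega) (by omega) (fun S hS hS' => ?_) (hins b rfl)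
          have := two_mul_card_le_of_mem_ballotSets hS
          rw [ha S (hmem S hS) (by omega), hlast S hS (by omega), add_zero]
        have h0 : ∀ S ∈ ballotSets v, a S = 0 := by
          have hat : ∀ S ∈ ballotSets v, t ≤ S.card → a S = 0 := fun S hS hS' => by
            simpa [hlast S hS hS'] using h1 S hS
          rcases t with _ | t
          · exact fun S hS => hat S hS (Nat.zero_le _)
          · exact ih (b := b + 1) (t := t) (by omega) (by omega) hat hout
        exact ⟨h0, fun S hS => by simpa [h0 S hS] using h1 S hS⟩
    intro S hS
    simp only [ballotSets, mem_union, mem_image, mem_filter] at hS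
    rcases hS with hS | ⟨S, ⟨hS, h2⟩, rfl⟩
    · exact key.1 S hS
    · simpa [lastCoeff, h2] using key.2 S hS

/-- Every function on the slice of `t`-subsets of `range v` is a combination of ballot monomials
of degree at most `t`. -/
lemma exists_ballotEval_eq {k : Type*} [Field k] {v t : ℕ} (h : 2 * t ≤ v)
    (f : powersetCard t (range v) → k) :
    ∃ a : Finset ℕ → k, (∀ S, t < S.card → a S = 0) ∧
      ∀ Y : powersetCard t (range v), ballotEval v a Y = f Y := by
  set B := (ballotSets v).filter fun S => S.card ≤ t with hB
  let ext : (B → k) → Finset ℕ → k := fun a S => if hS : S ∈ B then a ⟨S, hS⟩ else 0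
  let L : (B → k) →ₗ[k] (powersetCard t (range v) → k) :=
    { toFun := fun a Y => ballotEval v (ext a) Y
      map_add' := fun a a' => by
        ext Y
        simp only [ballotEval, Pi.add_apply, ← sum_add_distrib]
        refine sum_congr rfl fun S _ => ?_
        by_cases hS : S ∈ B <;> simp [ext, hS, ite_add_ite]
      map_smul' := fun r a => by
        ext Y
        simp only [ballotEval, Pi.smul_apply, smul_eq_mul, mul_sum, RingHom.id_apply]
        refine sum_congr rfl fun S _ => ?_
        by_cases hS : S ∈ B <;> simp [ext, hS] }
  have hext : ∀ (a : B → k) S, t < S.card → ext a S = 0 := fun a S hS =>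
    dif_neg fun hS' => by
      have := (mem_filter.1 hS').2
      omega
  have hinj : Function.Injective L := by
    rw [← LinearMap.ker_eq_bot, LinearMap.ker_eq_bot']
    intro a ha
    ext ⟨S, hS⟩
    have := eq_zero_of_ballotEval_eq_zero (a := ext a) le_rfl (by omega)
      (fun S _ => hext a S) (fun X hX => congrFun ha ⟨X, hX⟩) S (mem_filter.1 hS).1
    simpa only [ext, dif_pos hS, Pi.zero_apply] using this
  have hfin : Module.finrank k (B → k) = Module.finrank k (powersetCard t (range v) → k) := by
    simp only [Module.finrank_fintype_fun_eq_card, Fintype.card_coe, card_powersetCard,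
      card_range, hB, card_ballotSets_filter h]
  obtain ⟨a, ha⟩ := (LinearMap.injective_iff_surjective_of_finrank_eq_finrank hfin).1 hinj f
  exact ⟨ext a, hext a, fun Y => congrFun ha Y⟩

lemma sum_powersetCard_ballotEval {k : Type*} [Semiring k] {v t : ℕ} {a : Finset ℕ → k}
    (ha : ∀ S, t < S.card → a S = 0) (X : Finset ℕ) :
    ∑ Y ∈ powersetCard t X, ballotEval v a Y =
      ballotEval v (fun S => ((X.card - S.card).choose (t - S.card) : k) * a S) X := by
  simp only [ballotEval]
  rw [sum_comm]
  refine sum_congr rfl fun S _ => ?_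
  rw [← sum_filter, sum_const, nsmul_eq_mul]
  by_cases hS : S.card ≤ t
  · split_ifs with hSX
    · rw [card_filter_powersetCard_subset _ _ _ hSX hS]
    · rw [filter_false_of_mem]
      · simp
      · exact fun Y hY hSY => hSX (hSY.trans (mem_powersetCard.1 hY).1)
  · simp [ha S (by omega)]

lemma exists_sum_superset_eq_one {p : ℕ} {k : Type*} [Field k] [CharP k p] {v b t : ℕ}
    (htb : t ≤ b) (hbv : b + t ≤ v)
    (h : ∀ i ≤ t, p ∣ (b - i).choose (t - i) → p ∣ (v - i).choose (t - i)) :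
    ∃ c : Finset ℕ → k, ∀ Y ∈ powersetCard t (range v),
      ∑ X ∈ (powersetCard b (range v)).filter (Y ⊆ ·), c X = 1 := by
  let L : (Finset ℕ → k) →ₗ[k] (powersetCard t (range v) → k) :=
    { toFun := fun c Y => ∑ X ∈ (powersetCard b (range v)).filter (Y.1 ⊆ ·), c X
      map_add' := fun c c' => by ext Y; simp [sum_add_distrib]
      map_smul' := fun r c => by ext Y; simp [mul_sum] }
  suffices hL : (1 : powersetCard t (range v) → k) ∈ LinearMap.range L by
    obtain ⟨c, hc⟩ := hL
    exact ⟨c, fun Y hY => congrFun hc ⟨Y, hY⟩⟩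
  by_contra hL
  obtain ⟨φ, hφ, hker⟩ := Submodule.exists_le_ker_of_notMem hL
  obtain ⟨a, ha, haf⟩ := exists_ballotEval_eq (by omega) fun Y => φ (Pi.single Y 1)
  have hφf : ∀ g : Finset ℕ → k, φ (fun Y => g Y) =
      ∑ Y ∈ powersetCard t (range v), g Y * ballotEval v a Y := fun g => by
    rw [← sum_coe_sort, LinearMap.pi_apply_eq_sum_univ φ]
    refine sum_congr rfl fun Y _ => ?_
    rw [haf, smul_eq_mul]
    congr 2
    ext Z
    simp [Pi.single_apply, eq_comm]
  have hb : ∀ X ∈ powersetCard b (range v),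
      ballotEval v (fun S => ((b - S.card).choose (t - S.card) : k) * a S) X = 0 := by
    intro X hX
    have h1 : φ (L (Pi.single X 1)) = 0 := hker ⟨_, rfl⟩
    have h2 : L (Pi.single X 1) = fun Y => if Y.1 ⊆ X then 1 else 0 := by
      ext Y
      simp only [L, LinearMap.coe_mk, AddHom.coe_mk, Pi.single_apply, sum_ite_eq', mem_filter, hX,
        true_and]
    rw [h2, hφf fun Y => if Y ⊆ X then 1 else 0] at h1
    obtain ⟨hXv, hXb⟩ := mem_powersetCard.1 hX
    rw [← hXb, ← sum_powersetCard_ballotEval ha, ← h1]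
    simp only [ite_mul, one_mul, zero_mul, ← sum_filter]
    refine sum_congr ?_ fun _ _ => rfl
    ext Y
    simp only [mem_filter, mem_powersetCard]
    exact ⟨fun h => ⟨⟨h.1.trans hXv, h.2⟩, h.1⟩, fun h => ⟨h.2, h.1.2⟩⟩
  have hz := eq_zero_of_ballotEval_eq_zero htb hbv (fun S _ hS => by simp [ha S hS]) hb
  apply hφ
  have h1 := hφf fun _ => 1
  simp only [one_mul] at h1
  refine Eq.trans h1 ?_
  rw [sum_powersetCard_ballotEval ha, card_range]
  refine sum_eq_zero fun S hS => ?_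
  beta_reduce
  by_cases hSt : S.card ≤ t
  · rcases mul_eq_zero.1 (hz S hS) with hc | hc
    · rw [(CharP.cast_eq_zero_iff k p _).2 (h _ hSt ((CharP.cast_eq_zero_iff k p _).1 hc))]
      simp
    · simp [hc]
  · simp [ha S (by omega)]

/-- Wilson. Let `k` be a field of characteristic `p` and
`0 ≤ t < b ≤ v − t`. There exists a non-null `p`-ary `t`-design of block size `b` on
`{1,…,v}` if and only if for every `0 ≤ i ≤ t`, `C(b − i, t − i) ≡ 0 (mod p)` implies
`C(v − i, t − i) ≡ 0 (mod p)`. -/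
theorem wilson_existence (p : ℕ) (hp : p.Prime)
    (k : Type*) [Field k] [CharP k p]
    (v b t : ℕ) (htb : t < b) (hbv : b ≤ v - t) :
    (∃ (c : Finset (Fin v) → k) (μ : k), μ ≠ 0 ∧
        ∀ Y : Finset (Fin v), Y.card = t →
          ∑ X ∈ univ.filter (fun X : Finset (Fin v) => X.card = b ∧ Y ⊆ X), c X = μ) ↔
      ∀ i ≤ t, p ∣ Nat.choose (b - i) (t - i) → p ∣ Nat.choose (v - i) (t - i) := by
  constructor
  · rintro ⟨c, μ, hμ, hc⟩ i hi hdvd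
    obtain ⟨I, -, hI⟩ := exists_subset_card_eq (s := (univ : Finset (Fin v))) (n := i)
      (by rw [card_fin]; omega)
    have h1 : ∑ Y ∈ (powersetCard t univ).filter (I ⊆ ·),
        ∑ X ∈ univ.filter (fun X : Finset (Fin v) => X.card = b ∧ Y ⊆ X), c X =
          ((v - i).choose (t - i) : k) * μ := by
      rw [sum_congr rfl fun Y hY => hc Y (mem_powersetCard.1 (mem_filter.1 hY).1).2, sum_const,
        card_filter_powersetCard_subset _ _ _ (subset_univ _) (hI.trans_le hi), card_fin, hI,
        nsmul_eq_mul]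
    have h2 : ∑ Y ∈ (powersetCard t univ).filter (I ⊆ ·),
        ∑ X ∈ univ.filter (fun X : Finset (Fin v) => X.card = b ∧ Y ⊆ X), c X = 0 := by
      rw [sum_comm' (t' := univ.filter fun X : Finset (Fin v) => X.card = b ∧ I ⊆ X)
        (s' := fun X => (powersetCard t X).filter (I ⊆ ·))]
      · refine sum_eq_zero fun X hX => ?_
        simp only [mem_filter, mem_univ, true_and] at hX
        rw [sum_const, card_filter_powersetCard_subset _ _ _ hX.2 (hI.trans_le hi), hX.1, hI,
          nsmul_eq_mul, (CharP.cast_eq_zero_iff k p _).2 hdvd, zero_mul]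
      · intro Y X
        simp only [mem_filter, mem_powersetCard, mem_univ, subset_univ, true_and]
        exact ⟨fun h => ⟨⟨⟨h.2.2, h.1.1⟩, h.1.2⟩, h.2.1, h.1.2.trans h.2.2⟩,
          fun h => ⟨⟨h.1.1.2, h.1.2⟩, h.2.1, h.1.1.1⟩⟩
    have h3 := h1.symm.trans h2
    exact (CharP.cast_eq_zero_iff k p _).1 ((mul_eq_zero.1 h3).resolve_right hμ)
  · intro h
    obtain ⟨c, hc⟩ := exists_sum_superset_eq_one (k := k) htb.le (by omega : b + t ≤ v) h
    refine ⟨fun X => c (X.map Fin.valEmbedding), 1, one_ne_zero, fun Y hY => ?_⟩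
    have hmap : ∀ X : Finset (Fin v), X.map Fin.valEmbedding ⊆ range v := fun X x hx => by
      obtain ⟨y, -, rfl⟩ := mem_map.1 hx
      simp
    rw [← hc (Y.map Fin.valEmbedding) (mem_powersetCard.2 ⟨hmap Y, by rw [card_map, hY]⟩)]
    refine sum_bij (fun X _ => X.map Fin.valEmbedding) ?_ ?_ ?_ fun _ _ => rfl
    · intro X hX
      simp only [mem_filter, mem_univ, true_and] at hX
      rw [mem_filter, mem_powersetCard, card_map, map_subset_map]
      exact ⟨⟨hmap X, hX.1⟩, hX.2⟩
    · exact fun X _ X' _ h => map_injective _ h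
    · intro Z hZ
      rw [mem_filter, mem_powersetCard] at hZ
      obtain ⟨X, rfl⟩ : ∃ X : Finset (Fin v), X.map Fin.valEmbedding = Z := by
        refine ⟨Z.attachFin fun x hx => mem_range.1 (hZ.1.1 hx), ?_⟩
        exact map_valEmbedding_attachFin _
      refine ⟨X, ?_, rfl⟩
      rw [card_map, map_subset_map] at hZ
      simpa using ⟨hZ.1.2, hZ.2⟩
end

section
/- Let a ≥ b ≥ 1 be integers such that the pair (a,b) is pointed, say b = p^β + b̂ with b̂ < p^{ν_p(a+1)} < b, and let u be a non-null universal p-ary design for (a,b) with coefficient sequence (μ_0,…,μ_{b−1}). Then there exists α ∈ k such that μ_j = α·C(a+b−j, b−j) in k for all 0 ≤ j < b with j ≠ b̂. (Equivalently, u decomposes as the sum of a universal design that is non-null only as a b̂-design and a design similar to the constant design.) -/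
open Finset

section DoubleCounting

variable {V : Type*} [DecidableEq V]

theorem card_filter_powersetCard_superset {Y X : Finset V} (hYX : Y ⊆ X) {t : ℕ}
    (ht : Y.card ≤ t) :
    ((X.powersetCard t).filter (Y ⊆ ·)).card = (X.card - Y.card).choose (t - Y.card) := by
  rw [← card_sdiff_of_subset hYX, ← card_powersetCard]
  refine card_bij' (fun T _ => T \ Y) (fun S _ => Y ∪ S) ?_ ?_ ?_ ?_
  · intro T hT
    simp only [mem_filter, mem_powersetCard] at hT ⊢
    exact ⟨sdiff_subset_sdiff hT.1.1 subset_rfl, by rw [card_sdiff_of_subset hT.2, hT.1.2]⟩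
  · intro S hS
    simp only [mem_filter, mem_powersetCard] at hS ⊢
    have hd : Disjoint Y S := disjoint_of_subset_right hS.1 disjoint_sdiff
    refine ⟨⟨union_subset hYX (hS.1.trans sdiff_subset), ?_⟩, subset_union_left⟩
    rw [card_union_of_disjoint hd, hS.2]
    omega
  · intro T hT
    simp only [mem_filter] at hT
    exact union_sdiff_of_subset hT.2
  · intro S hS
    simp only [mem_powersetCard] at hS
    exact union_sdiff_cancel_left (disjoint_of_subset_right hS.1 disjoint_sdiff)

variable [Fintype V] {k : Type*} [CommSemiring k]

/-- Counting pairs `T ⊆ X` over a fixed `s`-set relates the coefficients of a function which is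
both an `s`-design and a `t`-design. -/
theorem design_coeff_relation {b s t : ℕ} (hst : s ≤ t) (hs : s ≤ Fintype.card V)
    (u : Finset V → k) (μ : ℕ → k)
    (hus : ∀ Y : Finset V, Y.card = s →
      ∑ X ∈ univ.filter (fun X : Finset V => X.card = b ∧ Y ⊆ X), u X = μ s)
    (hut : ∀ Y : Finset V, Y.card = t →
      ∑ X ∈ univ.filter (fun X : Finset V => X.card = b ∧ Y ⊆ X), u X = μ t) :
    ((Fintype.card V - s).choose (t - s) : k) * μ t = ((b - s).choose (t - s) : k) * μ s := by
  obtain ⟨Y, -, hY⟩ := exists_subset_card_eq (s := (univ : Finset V)) hs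
  have hleft : ∑ T ∈ (univ.powersetCard t).filter (Y ⊆ ·),
      ∑ X ∈ univ.filter (fun X : Finset V => X.card = b ∧ T ⊆ X), u X =
      ((Fintype.card V - s).choose (t - s) : k) * μ t := by
    rw [sum_congr rfl fun T hT => hut T (mem_powersetCard.1 (mem_filter.1 hT).1).2, sum_const,
      card_filter_powersetCard_superset (subset_univ Y) (by omega), card_univ, hY, nsmul_eq_mul]
  rw [← hleft, sum_comm' (t' := univ.filter (fun X : Finset V => X.card = b ∧ Y ⊆ X))
    (s' := fun X => (X.powersetCard t).filter (Y ⊆ ·)), ← hus Y hY, mul_sum]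
  · refine sum_congr rfl fun X hX => ?_
    simp only [mem_filter, mem_univ, true_and] at hX
    rw [sum_const, card_filter_powersetCard_superset hX.2 (by omega), hX.1, hY, nsmul_eq_mul]
  · intro T X
    simp only [mem_filter, mem_powersetCard, mem_univ, true_and, subset_univ]
    constructor
    · rintro ⟨⟨hT, hYT⟩, hX, hTX⟩
      exact ⟨⟨⟨hTX, hT⟩, hYT⟩, hX, hYT.trans hTX⟩
    · rintro ⟨⟨⟨hTX, hT⟩, hYT⟩, hX, -⟩
      exact ⟨⟨hT, hYT⟩, hX, hTX⟩

end DoubleCounting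

section Binomial

variable {p : ℕ} [Fact p.Prime]

theorem dvd_choose_prime_pow_iff (n e : ℕ) : p ∣ n.choose (p ^ e) ↔ p ∣ n / p ^ e := by
  have hp := (Fact.out : p.Prime)
  have h := Choose.choose_modEq_choose_mul_prod_range_choose (p := p) (n := n) (k := p ^ e) e
  have hprod : ∏ i ∈ range e, (n / p ^ i % p).choose (p ^ e / p ^ i % p) = 1 := by
    refine prod_eq_one fun i hi => ?_
    rw [mem_range] at hi
    rw [Nat.pow_div hi.le hp.pos, Nat.mod_eq_zero_of_dvd (dvd_pow_self p (by omega)),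
      Nat.choose_zero_right]
  rw [hprod, Nat.div_self (pow_pos hp.pos e), Nat.choose_one_right, Nat.cast_one, mul_one,
    Int.natCast_modEq_iff] at h
  exact h.dvd_iff dvd_rfl

theorem pow_mul_add_pow_sub_one_div_mod {ν i : ℕ} (A : ℕ) (hi : i < ν) :
    (p ^ ν * A + (p ^ ν - 1)) / p ^ i % p = p - 1 := by
  have hp := (Fact.out : p.Prime)
  obtain ⟨d, rfl⟩ := Nat.exists_eq_add_of_lt hi
  have hq : 0 < p ^ i := pow_pos hp.pos i
  have hd : 0 < p ^ d := pow_pos hp.pos d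
  obtain ⟨r, hr⟩ := Nat.exists_eq_add_of_le' hp.one_le
  have h1 : p ^ (i + d + 1) * A + (p ^ (i + d + 1) - 1) =
      (p ^ i - 1) + p ^ i * (p * (p ^ d * A + (p ^ d - 1)) + (p - 1)) := by
    obtain ⟨x, hx⟩ := Nat.exists_eq_add_of_le' hq
    obtain ⟨y, hy⟩ := Nat.exists_eq_add_of_le' hd
    rw [pow_succ, pow_add, hx, hy]
    have h2 : (x + 1) * (y + 1) * p - 1 = x + (x + 1) * (p * y + r) := by
      rw [hr, Nat.sub_eq_iff_eq_add (by nlinarith [Nat.zero_le (x * y)])]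
      ring
    simp only [Nat.add_sub_cancel]
    rw [h2, show p - 1 = r by omega]
    ring
  rw [h1, Nat.add_mul_div_left _ _ hq, Nat.div_eq_of_lt (by omega), zero_add,
    Nat.mul_add_mod, Nat.mod_eq_of_lt (by omega)]

theorem not_dvd_choose_of_lt_prime_pow {ν c : ℕ} (A : ℕ) (hc : c < p ^ ν) :
    ¬ p ∣ (p ^ ν * A + (p ^ ν - 1)).choose c := by
  have hp := (Fact.out : p.Prime)
  have h := Choose.choose_modEq_choose_mul_prod_range_choose (p := p)
    (n := p ^ ν * A + (p ^ ν - 1)) (k := c) ν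
  rw [Nat.div_eq_of_lt hc, Nat.choose_zero_right, Nat.cast_one, one_mul,
    Int.natCast_modEq_iff] at h
  rw [h.dvd_iff dvd_rfl, hp.prime.dvd_finsetProd_iff]
  rintro ⟨i, hi, hdvd⟩
  rw [pow_mul_add_pow_sub_one_div_mod A (mem_range.1 hi)] at hdvd
  have hle : c / p ^ i % p ≤ p - 1 := Nat.le_pred_of_lt (Nat.mod_lt _ hp.pos)
  have hfac := Nat.choose_mul_factorial_mul_factorial hle
  have := hp.dvd_factorial.1 (hfac ▸ (hdvd.mul_right _).mul_right _)
  have := hp.pos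
  omega

end Binomial

section Recurrence

variable {p : ℕ} [Fact p.Prime] {k : Type*} [Field k] [CharP k p]

/-- Here `m i` plays the role of the coefficient `μ (b - i)`. -/
theorem eq_zero_of_choose_relation {a b β r ν A : ℕ} (ha : a + 1 = p ^ ν * A) (hA : ¬ p ∣ A)
    (hb : b = p ^ β + r) (hr : r < p ^ ν) (hνb : p ^ ν < b) (m : ℕ → k)
    (hm : ∀ i j, 1 ≤ j → j ≤ i → i ≤ b →
      ((a + i).choose (i - j) : k) * m j = (i.choose j : k) * m i)
    (hmν : m (p ^ ν) = 0) {i : ℕ} (hi : 1 ≤ i) (hib : i ≤ b) (hiβ : i ≠ p ^ β) : m i = 0 := by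
  have hp := (Fact.out : p.Prime)
  have hqpos : 0 < p ^ ν := pow_pos hp.pos ν
  have cancel {n : ℕ} {x : k} (hn : ¬ p ∣ n) (h : (n : k) * x = 0) : x = 0 :=
    (mul_eq_zero.1 h).resolve_left fun h0 => hn ((CharP.cast_eq_zero_iff k p n).1 h0)
  have hpow (e : ℕ) (he : e ≤ ν) : m (p ^ e) = 0 := by
    have h := hm (p ^ ν) (p ^ e) (pow_pos hp.pos e) (Nat.pow_le_pow_right hp.pos he) hνb.le
    rw [hmν, mul_zero, show a + p ^ ν = p ^ ν * A + (p ^ ν - 1) by omega] at h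
    have := pow_pos hp.pos e
    exact cancel (not_dvd_choose_of_lt_prime_pow A (by omega)) h
  have hlow {j : ℕ} (hj : 1 ≤ j) (hjb : j ≤ b) (hdvd : ¬ p ^ (ν + 1) ∣ j) : m j = 0 := by
    obtain ⟨e, c, hc, rfl⟩ := Nat.exists_eq_pow_mul_and_not_dvd (n := j) (by omega) p hp.ne_one
    have he : e ≤ ν := by
      by_contra! h
      exact hdvd ((pow_dvd_pow p h).mul_right c)
    have h := hm (p ^ e * c) (p ^ e) (pow_pos hp.pos e)
      (Nat.le_of_dvd hj (dvd_mul_right _ _)) hjb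
    rw [hpow e he, mul_zero] at h
    refine cancel ?_ h.symm
    rwa [dvd_choose_prime_pow_iff, Nat.mul_div_cancel_left _ (pow_pos hp.pos e)]
  by_cases hdvd : p ^ (ν + 1) ∣ i
  · have hiq : i + p ^ ν ≤ b := by
      by_contra! hlt
      obtain ⟨c, rfl⟩ := (pow_dvd_pow p ν.le_succ).trans hdvd
      rcases le_or_gt ν β with hνβ | hβν
      · obtain ⟨d, hd⟩ := pow_dvd_pow p hνβ
        rw [hb, hd] at hib hlt
        rw [hd] at hiβ
        have h1 : c ≤ d := by
          by_contra! h
          nlinarith [Nat.mul_le_mul_left (p ^ ν) (Nat.succ_le_of_lt h)]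
        have h2 : d ≤ c := by
          by_contra! h
          nlinarith [Nat.mul_le_mul_left (p ^ ν) (Nat.succ_le_of_lt h)]
        exact hiβ (by rw [le_antisymm h1 h2])
      · have h1 := Nat.le_of_dvd hi hdvd
        have h2 := Nat.pow_lt_pow_right hp.one_lt hβν
        have h3 := Nat.mul_le_mul_left (p ^ ν) hp.two_le
        rw [pow_succ] at h1
        omega
    obtain ⟨c, rfl⟩ := hdvd
    have h := hm (p ^ (ν + 1) * c + p ^ ν) (p ^ (ν + 1) * c) hi (by omega) hiq
    rw [hlow (by omega) hiq, mul_zero, Nat.add_sub_cancel_left] at h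
    · refine cancel ?_ h
      rw [dvd_choose_prime_pow_iff]
      rw [show a + (p ^ (ν + 1) * c + p ^ ν) = (p ^ ν - 1) + p ^ ν * (A + p * c) by
        rw [mul_add, ← mul_assoc, ← pow_succ]; omega, Nat.add_mul_div_left _ _ hqpos,
        Nat.div_eq_of_lt (by omega), zero_add, Nat.dvd_add_left (dvd_mul_right p c)]
      exact hA
    · rw [Nat.dvd_add_right (dvd_mul_right _ _), Nat.pow_dvd_pow_iff_le_right hp.one_lt]
      omega
  · exact hlow hi hib hdvd

end Recurrence

/-- Let `k` be a field of characteristic `p` and `a ≥ b ≥ 1` with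
`(a,b)` pointed, say `b = p^β + b̂` with `b̂ < p^{ν_p(a+1)} < b`.  If `u` is a non-null
universal `p`-ary design for `(a,b)` with coefficients `μ_0, …, μ_{b−1}`, then there is
`α ∈ k` with `μ_j = α · C(a+b−j, b−j)` in `k` for all `j < b` with `j ≠ b̂`. -/
theorem pointed_design_decomposition (p : ℕ) (hp : p.Prime)
    (k : Type*) [Field k] [CharP k p]
    (a b β bhat : ℕ) (hb : 1 ≤ b) (hab : b ≤ a)
    (hbeq : b = p ^ β + bhat)
    (h1 : bhat < p ^ padicValNat p (a + 1))
    (h2 : p ^ padicValNat p (a + 1) < b)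
    (u : Finset (Fin (a + b)) → k) (μ : ℕ → k)
    (hu : ∀ t < b, ∀ Y : Finset (Fin (a + b)), Y.card = t →
        ∑ X ∈ univ.filter (fun X : Finset (Fin (a + b)) => X.card = b ∧ Y ⊆ X), u X = μ t)
    (hnonnull : ∃ t < b, μ t ≠ 0) :
    ∃ α : k, ∀ j < b, j ≠ bhat → μ j = α * (Nat.choose (a + b - j) (b - j) : k) := by
  have : Fact p.Prime := ⟨hp⟩
  set ν := padicValNat p (a + 1) with hν
  obtain ⟨A, hA⟩ : p ^ ν ∣ a + 1 := pow_padicValNat_dvd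
  have hpA : ¬ p ∣ A := by
    rintro ⟨c, rfl⟩
    refine pow_succ_padicValNat_not_dvd (p := p) (n := a + 1) (by omega) ⟨c, ?_⟩
    rw [← hν, hA, pow_succ, mul_assoc]
  have hqpos : 0 < p ^ ν := pow_pos hp.pos ν
  have hw : ((a + p ^ ν).choose (p ^ ν) : k) ≠ 0 := by
    rw [Ne, CharP.cast_eq_zero_iff k p, dvd_choose_prime_pow_iff,
      show a + p ^ ν = (p ^ ν - 1) + p ^ ν * A by omega, Nat.add_mul_div_left _ _ hqpos,
      Nat.div_eq_of_lt (by omega), zero_add]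
    exact hpA
  have hμ (i j : ℕ) (hj : 1 ≤ j) (hji : j ≤ i) (hib : i ≤ b) :
      ((a + i).choose (i - j) : k) * μ (b - j) = (i.choose j : k) * μ (b - i) := by
    have h := design_coeff_relation (b := b) (s := b - i) (t := b - j) (by omega)
      (by rw [Fintype.card_fin]; omega) u μ (hu _ (by omega)) (hu _ (by omega))
    rwa [Fintype.card_fin, show a + b - (b - i) = a + i by omega,
      show b - j - (b - i) = i - j by omega, show b - (b - i) = i by omega,
      Nat.choose_symm hji] at h
  set α : k := μ (b - p ^ ν) / ((a + p ^ ν).choose (p ^ ν) : k)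
  refine ⟨α, fun j hj hjb => ?_⟩
  have h := eq_zero_of_choose_relation hA hpA hbeq h1 h2
    (fun i => μ (b - i) - α * ((a + i).choose i : k)) ?_ ?_ (i := b - j) (by omega) (by omega)
    (by omega)
  · rw [sub_eq_zero, show b - (b - j) = j by omega] at h
    rw [h, show a + (b - j) = a + b - j by omega]
  · intro i j hj hji hib
    have hchoose := Nat.choose_mul (n := a + i) (Nat.sub_le i j)
    rw [Nat.choose_symm hji, show a + i - (i - j) = a + j by omega,
      show i - (i - j) = j by omega] at hchoose
    have hcast := congrArg (Nat.cast (R := k)) hchoose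
    push_cast at hcast
    linear_combination hμ i j hj hji hib + α * hcast
  · exact sub_eq_zero.2 (div_mul_cancel₀ _ hw).symm
end
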